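/- arXiv:2601.20606 — 2 statements merged into one kernel-verified Lean document; each statement's English description precedes it below -/
import Mathlib

section
/- (Theorem 1, stop-gradient form) The unconditional and conditional unbalanced mean flow matching losses differ by a constant independent of the trainable fields: there exists C ∈ ℝ, depending only on (ρ_c, u_c, g_c, q, μ, W, K, λ), such that for all measurable V : ℝ^d × Δ → ℝ^d and H : ℝ^d × Δ → ℝ for which all integrals below are finite, L(V,H) = L_c(V,H) + C, where L(V,H) := ∫_Δ ∫_{ℝ^d} (‖V(x,t,T) − T_v(x,t,T)‖² + λ·|H(x,t,T) − T_h(x,t,T)|²) ρ(x,t) dx dμ(t,T) and L_c(V,H) := ∫_Δ ∫_Z ∫_{ℝ^d} (‖V(x,t,T) − T_v^c(x,t,T,z)‖² + λ·|H(x,t,T) − T_h^c(x,t,T,z)|²) ρ_c(x,t,z) dx dq(z) dμ(t,T). -/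
open MeasureTheory RealInnerProductSpace

section Aux

variable {E F : Type*} [NormedAddCommGroup E] [InnerProductSpace ℝ E] [CompleteSpace E]
  [NormedAddCommGroup F] [NormedSpace ℝ F] [CompleteSpace F]

/-- The weighted integral of an affine conditional target. -/
lemma aux_target {Z : Type*} [MeasurableSpace Z] (q : Measure Z)
    (r : Z → ℝ) (w : Z → E) (f : Z → F) (hr : Integrable r q)
    (hw : Integrable (fun z => r z • w z) q) (hf : Integrable (fun z => r z • f z) q)
    (c : ℝ) (a : F) (L : E →L[ℝ] F) :
    Integrable (fun z => r z • (f z + c • (a + L (w z)))) q ∧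
    ∫ z, r z • (f z + c • (a + L (w z))) ∂q
      = (∫ z, r z • f z ∂q) + c • ((∫ z, r z ∂q) • a + L (∫ z, r z • w z ∂q)) := by
  have e : (fun z => r z • (f z + c • (a + L (w z))))
      = fun z => r z • f z + c • (r z • a + L (r z • w z)) := by
    funext z
    rw [map_smul]
    module
  have h1 : Integrable (fun z => r z • a) q := hr.smul_const a
  have h2 : Integrable (fun z => L (r z • w z)) q := L.integrable_comp hw
  have h3 : Integrable (fun z => c • (r z • a + L (r z • w z))) q := (h1.add h2).smul c
  rw [e]
  refine ⟨hf.add h3, ?_⟩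
  rw [integral_add hf h3, integral_smul, integral_add h1 h2, integral_smul_const,
    L.integral_comp_comm hw]

/-- Pointwise marginalisation of the difference between the loss and the squared targets. -/
lemma aux_marginal {Z : Type*} [MeasurableSpace Z] (q : Measure Z)
    (r : Z → ℝ) (hr : Integrable r q) (A : Z → E) (B : Z → ℝ)
    (hA : Integrable (fun z => r z • A z) q) (hB : Integrable (fun z => r z • B z) q)
    (R : ℝ) (hR : ∫ z, r z ∂q = R) (a : E) (b : ℝ)
    (ha : ∫ z, r z • A z ∂q = R • a) (hb : ∫ z, r z • B z ∂q = R • b)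
    (lam : ℝ) (v : E) (h : ℝ) :
    ∫ z, ((‖v - A z‖ ^ 2 + lam * |h - B z| ^ 2) * r z
        - (‖A z‖ ^ 2 * r z + lam * (|B z| ^ 2 * r z))) ∂q
      = (‖v - a‖ ^ 2 + lam * |h - b| ^ 2) * R - (‖a‖ ^ 2 * R + lam * (|b| ^ 2 * R)) := by
  have key : ∀ (A : E) (B r : ℝ), (‖v - A‖ ^ 2 + lam * |h - B| ^ 2) * r
        - (‖A‖ ^ 2 * r + lam * (|B| ^ 2 * r))
      = (‖v‖ ^ 2 + lam * h ^ 2) * r - 2 * ⟪v, r • A⟫ - 2 * lam * h * (r • B) := by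
    intro A B r
    rw [norm_sub_sq_real, sq_abs, sq_abs, real_inner_smul_right, smul_eq_mul]
    ring
  have i1 : Integrable (fun z => (‖v‖ ^ 2 + lam * h ^ 2) * r z) q := hr.const_mul _
  have i2 : Integrable (fun z => 2 * ⟪v, r z • A z⟫) q := (hA.const_inner v).const_mul 2
  have i3 : Integrable (fun z => 2 * lam * h * (r z • B z)) q := hB.const_mul _
  simp_rw [key]
  have i12 : Integrable (fun z => (‖v‖ ^ 2 + lam * h ^ 2) * r z - 2 * ⟪v, r z • A z⟫) q :=
    i1.sub i2
  rw [integral_sub i12 i3, integral_sub i1 i2, integral_const_mul, integral_const_mul,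
    integral_const_mul, integral_inner hA, hR, ha, hb]

end Aux

/-- **Theorem 1, stop-gradient form.** The unconditional and conditional
unbalanced mean flow matching losses differ by a constant independent of the trainable
fields: there exists `C ∈ ℝ`, depending only on `(ρ_c, u_c, g_c, q, μ, W, K, λ)`, such
that for all measurable `V : ℝ^d × Δ → ℝ^d` and `H : ℝ^d × Δ → ℝ` for which all the
integrals below are finite, `L(V,H) = L_c(V,H) + C`, where
`L(V,H) = ∫_Δ ∫ (‖V − T_v‖² + λ |H − T_h|²) ρ dx dμ(t,T)` and
`L_c(V,H) = ∫_Δ ∫_Z ∫ (‖V − T_v^c‖² + λ |H − T_h^c|²) ρ_c dx dq(z) dμ(t,T)`. -/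
theorem unconditional_eq_conditional_loss_add_const (d : ℕ)
    {Z : Type*} [MeasurableSpace Z] (q : Measure Z) [SigmaFinite q]
    (ρc : EuclideanSpace ℝ (Fin d) → ℝ → Z → ℝ)
    (uc : EuclideanSpace ℝ (Fin d) → ℝ → Z → EuclideanSpace ℝ (Fin d))
    (gc : EuclideanSpace ℝ (Fin d) → ℝ → Z → ℝ)
    (hρc_meas : Measurable fun p : (EuclideanSpace ℝ (Fin d) × ℝ) × Z => ρc p.1.1 p.1.2 p.2)
    (huc_meas : Measurable fun p : (EuclideanSpace ℝ (Fin d) × ℝ) × Z => uc p.1.1 p.1.2 p.2)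
    (hgc_meas : Measurable fun p : (EuclideanSpace ℝ (Fin d) × ℝ) × Z => gc p.1.1 p.1.2 p.2)
    (hρc_nonneg : ∀ x t z, 0 ≤ ρc x t z)
    -- the marginal density, velocity and growth rate, with their defining equations
    (ρ : EuclideanSpace ℝ (Fin d) → ℝ → ℝ)
    (hρdef : ∀ x t, ρ x t = ∫ z, ρc x t z ∂q)
    (hρ_int : ∀ x t, Integrable (fun z => ρc x t z) q)
    (hρ_pos : ∀ x t, 0 < ρ x t)
    (u : EuclideanSpace ℝ (Fin d) → ℝ → EuclideanSpace ℝ (Fin d))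
    (hudef : ∀ x t, u x t = (ρ x t)⁻¹ • ∫ z, ρc x t z • uc x t z ∂q)
    (hflux_int : ∀ x t, Integrable (fun z => ρc x t z • uc x t z) q)
    (g : EuclideanSpace ℝ (Fin d) → ℝ → ℝ)
    (hgdef : ∀ x t, g x t = (∫ z, gc x t z * ρc x t z ∂q) / ρ x t)
    (hgrow_int : ∀ x t, Integrable (fun z => gc x t z * ρc x t z) q)
    -- a probability measure concentrated on Δ = {(t,T) : 0 < t < T < 1}
    (μ : Measure (ℝ × ℝ)) [IsProbabilityMeasure μ]
    (hμ : ∀ᵐ p ∂μ, 0 < p.1 ∧ p.1 < p.2 ∧ p.2 < 1)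
    (lam : ℝ) (hlam : 0 < lam)
    -- the frozen (stop-gradient) fields, continuously differentiable in (x,t)
    (W : EuclideanSpace ℝ (Fin d) → ℝ → ℝ → EuclideanSpace ℝ (Fin d))
    (K : EuclideanSpace ℝ (Fin d) → ℝ → ℝ → ℝ)
    (hW : ∀ T, ContDiff ℝ 1 fun p : EuclideanSpace ℝ (Fin d) × ℝ => W p.1 p.2 T)
    (hK : ∀ T, ContDiff ℝ 1 fun p : EuclideanSpace ℝ (Fin d) × ℝ => K p.1 p.2 T)
    -- the conditional targets
    (Tvc : EuclideanSpace ℝ (Fin d) → ℝ → ℝ → Z → EuclideanSpace ℝ (Fin d))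
    (hTvc : ∀ x t T z, Tvc x t T z
      = uc x t z + (T - t) •
          (deriv (fun s => W x s T) t + fderiv ℝ (fun y => W y t T) x (uc x t z)))
    (Thc : EuclideanSpace ℝ (Fin d) → ℝ → ℝ → Z → ℝ)
    (hThc : ∀ x t T z, Thc x t T z
      = gc x t z + (T - t) *
          (deriv (fun s => K x s T) t + fderiv ℝ (fun y => K y t T) x (uc x t z)))
    -- the marginal targets
    (Tv : EuclideanSpace ℝ (Fin d) → ℝ → ℝ → EuclideanSpace ℝ (Fin d))
    (hTv : ∀ x t T, Tv x t T
      = u x t + (T - t) •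
          (deriv (fun s => W x s T) t + fderiv ℝ (fun y => W y t T) x (u x t)))
    (Th : EuclideanSpace ℝ (Fin d) → ℝ → ℝ → ℝ)
    (hTh : ∀ x t T, Th x t T
      = g x t + (T - t) *
          (deriv (fun s => K x s T) t + fderiv ℝ (fun y => K y t T) x (u x t)))
    -- all displayed integrals involving the fixed data are finite
    (hTvc_sq_int : Integrable
      (fun p : (ℝ × ℝ) × Z × EuclideanSpace ℝ (Fin d) =>
        ‖Tvc p.2.2 p.1.1 p.1.2 p.2.1‖ ^ 2 * ρc p.2.2 p.1.1 p.2.1)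
      (μ.prod (q.prod volume)))
    (hThc_sq_int : Integrable
      (fun p : (ℝ × ℝ) × Z × EuclideanSpace ℝ (Fin d) =>
        |Thc p.2.2 p.1.1 p.1.2 p.2.1| ^ 2 * ρc p.2.2 p.1.1 p.2.1)
      (μ.prod (q.prod volume)))
    (hTv_sq_int : Integrable
      (fun p : (ℝ × ℝ) × EuclideanSpace ℝ (Fin d) =>
        ‖Tv p.2 p.1.1 p.1.2‖ ^ 2 * ρ p.2 p.1.1) (μ.prod volume))
    (hTh_sq_int : Integrable
      (fun p : (ℝ × ℝ) × EuclideanSpace ℝ (Fin d) =>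
        |Th p.2 p.1.1 p.1.2| ^ 2 * ρ p.2 p.1.1) (μ.prod volume)) :
    ∃ C : ℝ, ∀ (V : EuclideanSpace ℝ (Fin d) → ℝ → ℝ → EuclideanSpace ℝ (Fin d))
        (H : EuclideanSpace ℝ (Fin d) → ℝ → ℝ → ℝ),
      Measurable (fun p : EuclideanSpace ℝ (Fin d) × ℝ × ℝ => V p.1 p.2.1 p.2.2) →
      Measurable (fun p : EuclideanSpace ℝ (Fin d) × ℝ × ℝ => H p.1 p.2.1 p.2.2) →
      -- all displayed integrals involving V and H are finite
      Integrable (fun p : (ℝ × ℝ) × EuclideanSpace ℝ (Fin d) =>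
        (‖V p.2 p.1.1 p.1.2 - Tv p.2 p.1.1 p.1.2‖ ^ 2
          + lam * |H p.2 p.1.1 p.1.2 - Th p.2 p.1.1 p.1.2| ^ 2) * ρ p.2 p.1.1)
        (μ.prod volume) →
      Integrable (fun p : (ℝ × ℝ) × Z × EuclideanSpace ℝ (Fin d) =>
        (‖V p.2.2 p.1.1 p.1.2 - Tvc p.2.2 p.1.1 p.1.2 p.2.1‖ ^ 2
          + lam * |H p.2.2 p.1.1 p.1.2 - Thc p.2.2 p.1.1 p.1.2 p.2.1| ^ 2)
          * ρc p.2.2 p.1.1 p.2.1)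
        (μ.prod (q.prod volume)) →
      Integrable (fun p : (ℝ × ℝ) × Z × EuclideanSpace ℝ (Fin d) =>
        ‖V p.2.2 p.1.1 p.1.2‖ ^ 2 * ρc p.2.2 p.1.1 p.2.1) (μ.prod (q.prod volume)) →
      Integrable (fun p : (ℝ × ℝ) × Z × EuclideanSpace ℝ (Fin d) =>
        |H p.2.2 p.1.1 p.1.2| ^ 2 * ρc p.2.2 p.1.1 p.2.1) (μ.prod (q.prod volume)) →
      Integrable (fun p : (ℝ × ℝ) × Z × EuclideanSpace ℝ (Fin d) =>
        ⟪V p.2.2 p.1.1 p.1.2, Tvc p.2.2 p.1.1 p.1.2 p.2.1⟫ * ρc p.2.2 p.1.1 p.2.1)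
        (μ.prod (q.prod volume)) →
      Integrable (fun p : (ℝ × ℝ) × Z × EuclideanSpace ℝ (Fin d) =>
        H p.2.2 p.1.1 p.1.2 * Thc p.2.2 p.1.1 p.1.2 p.2.1 * ρc p.2.2 p.1.1 p.2.1)
        (μ.prod (q.prod volume)) →
      -- the unconditional loss equals the conditional loss plus the constant C
      (∫ p, (∫ x,
          (‖V x p.1 p.2 - Tv x p.1 p.2‖ ^ 2
            + lam * |H x p.1 p.2 - Th x p.1 p.2| ^ 2) * ρ x p.1) ∂μ)
        = (∫ p, (∫ z, (∫ x,
            (‖V x p.1 p.2 - Tvc x p.1 p.2 z‖ ^ 2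
              + lam * |H x p.1 p.2 - Thc x p.1 p.2 z| ^ 2) * ρc x p.1 z) ∂q) ∂μ) + C := by
  have hne : ∀ x t, ρ x t ≠ 0 := fun x t => (hρ_pos x t).ne'
  have hu : ∀ x t, ∫ z, ρc x t z • uc x t z ∂q = ρ x t • u x t := by
    intro x t
    rw [hudef, smul_smul, mul_inv_cancel₀ (hne x t), one_smul]
  have hgi : ∀ x t, Integrable (fun z => ρc x t z • gc x t z) q := by
    intro x t
    simpa only [smul_eq_mul, mul_comm] using hgrow_int x t
  have hg : ∀ x t, ∫ z, ρc x t z • gc x t z ∂q = ρ x t • g x t := by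
    intro x t
    rw [hgdef, smul_eq_mul, mul_div_cancel₀ _ (hne x t)]
    simp only [smul_eq_mul, mul_comm]
  have hv : ∀ x t T, Integrable (fun z => ρc x t z • Tvc x t T z) q ∧
      ∫ z, ρc x t z • Tvc x t T z ∂q = ρ x t • Tv x t T := by
    intro x t T
    obtain ⟨h1, h2⟩ := aux_target q (ρc x t) (uc x t) (uc x t) (hρ_int x t) (hflux_int x t)
      (hflux_int x t) (T - t) (deriv (fun s => W x s T) t) (fderiv ℝ (fun y => W y t T) x)
    simp_rw [hTvc, hTv]
    refine ⟨h1, h2.trans ?_⟩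
    rw [hu, ← hρdef, map_smul]
    module
  have hh : ∀ x t T, Integrable (fun z => ρc x t z • Thc x t T z) q ∧
      ∫ z, ρc x t z • Thc x t T z ∂q = ρ x t • Th x t T := by
    intro x t T
    obtain ⟨h1, h2⟩ := aux_target q (ρc x t) (uc x t) (gc x t) (hρ_int x t) (hflux_int x t)
      (hgi x t) (T - t) (deriv (fun s => K x s T) t) (fderiv ℝ (fun y => K y t T) x)
    simp_rw [hThc, hTh]
    refine ⟨h1, h2.trans ?_⟩
    rw [hg, hu, ← hρdef, map_smul]
    simp only [smul_eq_mul]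
    ring
  have hS := hTv_sq_int.add (hTh_sq_int.const_mul lam)
  have hSc := hTvc_sq_int.add (hThc_sq_int.const_mul lam)
  refine ⟨(∫ p : (ℝ × ℝ) × EuclideanSpace ℝ (Fin d), (‖Tv p.2 p.1.1 p.1.2‖ ^ 2 * ρ p.2 p.1.1
        + lam * (|Th p.2 p.1.1 p.1.2| ^ 2 * ρ p.2 p.1.1)) ∂(μ.prod volume))
      - ∫ p : (ℝ × ℝ) × Z × EuclideanSpace ℝ (Fin d),
        (‖Tvc p.2.2 p.1.1 p.1.2 p.2.1‖ ^ 2 * ρc p.2.2 p.1.1 p.2.1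
        + lam * (|Thc p.2.2 p.1.1 p.1.2 p.2.1| ^ 2 * ρc p.2.2 p.1.1 p.2.1))
          ∂(μ.prod (q.prod volume)), ?_⟩
  intro V H _ _ hL hLc _ _ _ _
  have hD := hL.sub hS
  have hDc := hLc.sub hSc
  have e1 := integral_sub hL hS
  have e2 := integral_sub hLc hSc
  have e3 := integral_prod _ hD
  have e4 := integral_prod _ hDc
  have e5 := integral_prod _ hL
  have e6 := integral_prod _ hLc
  have e7 := integral_congr_ae (hLc.prod_right_ae.mono fun p hp => integral_prod _ hp)
  have e8 := integral_congr_ae (hDc.prod_right_ae.mono fun p hp => integral_prod_symm _ hp)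
  simp only [Pi.sub_apply, Pi.add_apply] at e1 e2 e3 e4 e5 e6 e7 e8
  have e9 : ∀ (p : ℝ × ℝ) (x : EuclideanSpace ℝ (Fin d)), _ := fun p x =>
    aux_marginal q (ρc x p.1) (hρ_int x p.1) (Tvc x p.1 p.2) (Thc x p.1 p.2)
      (hv x p.1 p.2).1 (hh x p.1 p.2).1 (ρ x p.1) (hρdef x p.1).symm (Tv x p.1 p.2)
      (Th x p.1 p.2) (hv x p.1 p.2).2 (hh x p.1 p.2).2 lam (V x p.1 p.2) (H x p.1 p.2)
  simp_rw [e9] at e8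
  linarith
end

section
/- The travelling-Dirac mass profile is strictly positive: if τ ≠ 0, then A > 0 and m(t) := A t² − 2B t + m₀ > 0 for every t ∈ ℝ. -/
/-- The travelling-Dirac mass profile is strictly positive: if `τ ≠ 0`,
then `A > 0` and `m(t) := A t² − 2B t + m₀ > 0` for every `t ∈ ℝ`. -/
theorem travellingDirac_mass_positive
    (m₀ m₁ τ : ℝ) (hm₀ : 0 < m₀) (hm₁ : 0 < m₁) (hτ : τ ≠ 0)
    (s A B : ℝ)
    (hs : s = Real.sqrt (m₀ * m₁ / (1 + τ ^ 2)))
    (hA : A = m₀ + m₁ - 2 * s)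
    (hB : B = m₀ - s) :
    0 < A ∧ ∀ t : ℝ, 0 < A * t ^ 2 - 2 * B * t + m₀ := by
  have hτ2 : 0 < τ ^ 2 := by positivity
  have hp : 0 < m₀ * m₁ := mul_pos hm₀ hm₁
  have hs2 : s ^ 2 < m₀ * m₁ := by
    rw [hs, Real.sq_sqrt (by positivity)]
    exact div_lt_self hp (by linarith)
  have hD : 0 < A * m₀ - B ^ 2 := by
    have : A * m₀ - B ^ 2 = m₀ * m₁ - s ^ 2 := by rw [hA, hB]; ring
    linarith
  constructor
  · have h : 0 < A * m₀ := by nlinarith [sq_nonneg B]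
    exact pos_of_mul_pos_left h hm₀.le
  · intro t
    rcases eq_or_ne t 0 with rfl | ht
    · simpa using hm₀
    · have ht2 : 0 < t ^ 2 := by positivity
      have h : 0 < (A * t ^ 2 - 2 * B * t + m₀) * m₀ := by
        have e : (A * t ^ 2 - 2 * B * t + m₀) * m₀
            = (m₀ - B * t) ^ 2 + (A * m₀ - B ^ 2) * t ^ 2 := by ring
        rw [e]
        have := mul_pos hD ht2
        have := sq_nonneg (m₀ - B * t)
        linarith
      exact pos_of_mul_pos_left h hm₀.le
end
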